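/- Let π be a μ-projective unitary representation of a countable discrete group G on a complex separable Hilbert space H such that the set B_π of Bessel vectors of π is dense in H and there exists η ∈ H for which {π(g)η}_{g∈G} is a Riesz sequence. Let ξ ∈ H. If the closure in ℓ²(G) of {Θ_ξ(y) : y ∈ D(Θ_ξ)} is not all of ℓ²(G), then there exists x ∈ H with x ≠ 0 such that ⟨Θ_x(y), Θ_ξ(z)⟩ = 0 for all y ∈ D(Θ_x) and z ∈ D(Θ_ξ). -/

import Mathlib

open scoped InnerProductSpace

noncomputable section

variable {G : Type*} {H : Type*} [NormedAddCommGroup H] [InnerProductSpace ℂ H]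

/-- `π` is a projective unitary representation of `G` on `H` with multiplier `mu`:
each `π g` is a unitary operator (a surjective linear isometry) and
`π g ∘ π h = mu g h • π (g * h)`, where `|mu g h| = 1`. -/
def IsProjUnitaryRep [Group G] (mu : G → G → ℂ) (π : G → H →L[ℂ] H) : Prop :=
  (∀ g h, ‖mu g h‖ = 1) ∧
  (∀ g, (∀ x : H, ‖π g x‖ = ‖x‖) ∧ Function.Surjective (π g)) ∧
  (∀ g h, (π g).comp (π h) = mu g h • π (g * h))

/-- `π` is a unitary representation of `G` on `H`. -/
def IsUnitaryRep [Group G] (π : G → H →L[ℂ] H) : Prop :=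
  (∀ g, (∀ x : H, ‖π g x‖ = ‖x‖) ∧ Function.Surjective (π g)) ∧
  (∀ g h, (π g).comp (π h) = π (g * h))

/-- `ξ` is a Bessel vector for `π`: `∑_g |⟨x, π g ξ⟩|² ≤ B‖x‖²` for all `x ∈ H`
(expressed via finite partial sums). -/
def IsBesselVector (π : G → H →L[ℂ] H) (ξ : H) : Prop :=
  ∃ B : ℝ, 0 < B ∧ ∀ x : H, ∀ s : Finset G, ∑ g ∈ s, ‖⟪x, π g ξ⟫_ℂ‖ ^ 2 ≤ B * ‖x‖ ^ 2

/-- `{π g ξ}_{g ∈ G}` satisfies the frame inequalities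
`A‖x‖² ≤ ∑_g |⟨x, π g ξ⟩|² ≤ B‖x‖²` for all `x` in the set `M`. -/
def IsFrameOn (π : G → H →L[ℂ] H) (ξ : H) (M : Set H) : Prop :=
  ∃ A B : ℝ, 0 < A ∧ A ≤ B ∧ ∀ x ∈ M,
    Summable (fun g : G => ‖⟪x, π g ξ⟫_ℂ‖ ^ 2) ∧
    A * ‖x‖ ^ 2 ≤ ∑' g : G, ‖⟪x, π g ξ⟫_ℂ‖ ^ 2 ∧
    ∑' g : G, ‖⟪x, π g ξ⟫_ℂ‖ ^ 2 ≤ B * ‖x‖ ^ 2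

/-- The closed linear span of the orbit `{π g ξ : g ∈ G}`. -/
def orbitSpan (π : G → H →L[ℂ] H) (ξ : H) : Set H :=
  closure (Submodule.span ℂ (Set.range fun g : G => π g ξ) : Set H)

/-- `{π g ξ}_{g ∈ G}` is a frame sequence: a frame for its closed linear span. -/
def IsFrameSequence (π : G → H →L[ℂ] H) (ξ : H) : Prop :=
  IsFrameOn π ξ (orbitSpan π ξ)

/-- `ξ` is a complete frame vector for `π`: `{π g ξ}_{g ∈ G}` is a frame for `H`. -/
def IsCompleteFrameVector (π : G → H →L[ℂ] H) (ξ : H) : Prop :=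
  IsFrameOn π ξ Set.univ

/-- `{π g ξ}_{g ∈ G}` is a Parseval frame on the set `M`:
`∑_g |⟨x, π g ξ⟩|² = ‖x‖²` for all `x ∈ M`. -/
def IsParsevalFrameOn (π : G → H →L[ℂ] H) (ξ : H) (M : Set H) : Prop :=
  ∀ x ∈ M, HasSum (fun g : G => ‖⟪x, π g ξ⟫_ℂ‖ ^ 2) (‖x‖ ^ 2)

/-- `{π g η}_{g ∈ G}` is a Riesz sequence:
`A ∑ |c g|² ≤ ‖∑ c g • π g η‖² ≤ B ∑ |c g|²` for all finitely supported `c`. -/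
def IsRieszSequence (π : G → H →L[ℂ] H) (η : H) : Prop :=
  ∃ A B : ℝ, 0 < A ∧ A ≤ B ∧ ∀ c : G →₀ ℂ,
    A * ∑ g ∈ c.support, ‖c g‖ ^ 2 ≤ ‖∑ g ∈ c.support, c g • π g η‖ ^ 2 ∧
    ‖∑ g ∈ c.support, c g • π g η‖ ^ 2 ≤ B * ∑ g ∈ c.support, ‖c g‖ ^ 2

/-- The commutant `S' = {T : T A = A T for all A ∈ S}` of a set `S` of operators. -/
def commutant (S : Set (H →L[ℂ] H)) : Set (H →L[ℂ] H) := Set.centralizer S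

/-- `(π, σ)` is a commuting pair: `π(G)' = σ(G)''`. -/
def IsCommutingPair (π σ : G → H →L[ℂ] H) : Prop :=
  commutant (Set.range π) = commutant (commutant (Set.range σ))

end

/-- `x` and `y` are `π`-orthogonal: the ranges of the analysis operators `Θ_x` and `Θ_y`
are orthogonal in `ℓ²(G)`, i.e. `⟨Θ_x a, Θ_y b⟩ = 0` for all `a ∈ D(Θ_x)`, `b ∈ D(Θ_y)`. -/
def PiOrthogonal {G : Type*} {H : Type*} [NormedAddCommGroup H] [InnerProductSpace ℂ H]
    (π : G → H →L[ℂ] H) (x y : H) : Prop :=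
  ∀ a b : H, Summable (fun g : G => ‖⟪a, π g x⟫_ℂ‖ ^ 2) →
    Summable (fun g : G => ‖⟪b, π g y⟫_ℂ‖ ^ 2) →
    ∑' g : G, (starRingEnd ℂ) ⟪a, π g x⟫_ℂ * ⟪b, π g y⟫_ℂ = 0

open Classical in
/-- The bounds of a Riesz sequence, for coefficients indexed by an arbitrary finite set. -/
theorem IsRieszSequence.exists_bounds {G : Type*} {H : Type*} [NormedAddCommGroup H]
    [InnerProductSpace ℂ H] {π : G → H →L[ℂ] H} {η : H} (h : IsRieszSequence π η) :
    ∃ A B : ℝ, 0 < A ∧ 0 < B ∧ ∀ (s : Finset G) (c : G → ℂ),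
      A * ∑ g ∈ s, ‖c g‖ ^ 2 ≤ ‖∑ g ∈ s, c g • π g η‖ ^ 2 ∧
      ‖∑ g ∈ s, c g • π g η‖ ^ 2 ≤ B * ∑ g ∈ s, ‖c g‖ ^ 2 := by
  obtain ⟨A, B, hA, hAB, h⟩ := h
  refine ⟨A, B, hA, hA.trans_le hAB, fun s c => ?_⟩
  let d : G →₀ ℂ := Finsupp.onFinset s (fun g => if g ∈ s then c g else 0) (by
    intro g hg; by_contra hs; simp [hs] at hg)
  have hd : ∀ g ∈ s, d g = c g := fun g hg => by simp [d, hg]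
  have hsub : d.support ⊆ s := Finsupp.support_onFinset_subset
  have h₁ : ∑ g ∈ d.support, ‖d g‖ ^ 2 = ∑ g ∈ s, ‖c g‖ ^ 2 := by
    rw [Finset.sum_subset hsub fun g _ hg => by simp [Finsupp.notMem_support_iff.1 hg]]
    exact Finset.sum_congr rfl fun g hg => by rw [hd g hg]
  have h₂ : ∑ g ∈ d.support, d g • π g η = ∑ g ∈ s, c g • π g η := by
    rw [Finset.sum_subset hsub fun g _ hg => by simp [Finsupp.notMem_support_iff.1 hg]]
    exact Finset.sum_congr rfl fun g hg => by rw [hd g hg]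
  simpa only [h₁, h₂] using h d

/-- A family whose synthesis map satisfies an upper bound is a Bessel family. -/
theorem sum_norm_inner_sq_le_of_norm_sum_smul_sq_le {ι H : Type*} [NormedAddCommGroup H]
    [InnerProductSpace ℂ H] {e : ι → H} {B : ℝ} (hB : 0 < B)
    (h : ∀ (s : Finset ι) (c : ι → ℂ), ‖∑ i ∈ s, c i • e i‖ ^ 2 ≤ B * ∑ i ∈ s, ‖c i‖ ^ 2)
    (y : H) (s : Finset ι) : ∑ i ∈ s, ‖⟪e i, y⟫_ℂ‖ ^ 2 ≤ B * ‖y‖ ^ 2 := by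
  set S := ∑ i ∈ s, ‖⟪e i, y⟫_ℂ‖ ^ 2 with hS
  set z := ∑ i ∈ s, ⟪e i, y⟫_ℂ • e i with hz
  have hS0 : 0 ≤ S := Finset.sum_nonneg fun i _ => by positivity
  have hzS : ‖z‖ ^ 2 ≤ B * S := h s fun i => ⟪e i, y⟫_ℂ
  have hinner : ⟪z, y⟫_ℂ = (S : ℂ) := by
    rw [hz, sum_inner, hS]
    push_cast
    refine Finset.sum_congr rfl fun i _ => ?_
    rw [inner_smul_left, mul_comm, Complex.mul_conj']
  have hle : S ≤ ‖z‖ * ‖y‖ := by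
    have := norm_inner_le_norm (𝕜 := ℂ) z y
    rwa [hinner, Complex.norm_real, Real.norm_of_nonneg hS0] at this
  rcases hS0.eq_or_lt with h0 | h0
  · rw [← h0]; positivity
  · have : S * S ≤ S * (B * ‖y‖ ^ 2) := by
      calc S * S ≤ (‖z‖ * ‖y‖) * (‖z‖ * ‖y‖) := by gcongr
        _ = ‖z‖ ^ 2 * ‖y‖ ^ 2 := by ring
        _ ≤ (B * S) * ‖y‖ ^ 2 := by gcongr
        _ = S * (B * ‖y‖ ^ 2) := by ring
    exact le_of_mul_le_mul_left this h0

theorem memℓp_two_iff_summable_sq {ι : Type*} {f : ι → ℂ} :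
    Memℓp f 2 ↔ Summable fun i => ‖f i‖ ^ 2 := by
  rw [memℓp_gen_iff (by norm_num)]
  norm_num

theorem lp_two_norm_sq_eq_tsum {ι : Type*} (f : lp (fun _ : ι => ℂ) 2) :
    ‖f‖ ^ 2 = ∑' i, ‖f i‖ ^ 2 := by
  have := lp.norm_rpow_eq_tsum (p := 2) (by norm_num) f
  norm_num at this
  exact_mod_cast this

/-- The analysis operator of a Bessel family. -/
theorem exists_analysis_operator {ι H : Type*} [NormedAddCommGroup H]
    [InnerProductSpace ℂ H] {e : ι → H} {B : ℝ}
    (h : ∀ (y : H) (s : Finset ι), ∑ i ∈ s, ‖⟪e i, y⟫_ℂ‖ ^ 2 ≤ B * ‖y‖ ^ 2) :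
    ∃ Φ : H →L[ℂ] lp (fun _ : ι => ℂ) 2, ∀ y i, Φ y i = ⟪e i, y⟫_ℂ := by
  have hsum : ∀ y, Summable fun i => ‖⟪e i, y⟫_ℂ‖ ^ 2 := fun y =>
    summable_of_sum_le (fun i => by positivity) (h y)
  let Φ : H →ₗ[ℂ] lp (fun _ : ι => ℂ) 2 :=
    { toFun := fun y => ⟨fun i => ⟪e i, y⟫_ℂ, memℓp_two_iff_summable_sq.2 (hsum y)⟩
      map_add' := fun y z => by ext i; exact inner_add_right _ _ _
      map_smul' := fun a y => by ext i; simp }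
  refine ⟨Φ.mkContinuous (√B) fun y => ?_, fun y i => rfl⟩
  rw [← Real.sqrt_sq (norm_nonneg (Φ y)), ← Real.sqrt_sq (norm_nonneg y),
    ← Real.sqrt_mul' _ (sq_nonneg _)]
  refine Real.sqrt_le_sqrt ?_
  rw [lp_two_norm_sq_eq_tsum]
  exact (hsum y).tsum_le_of_sum_le (h y)

/-- The synthesis operator of a Riesz sequence is bounded and injective on `ℓ²(G)`. -/
theorem IsRieszSequence.exists_synthesis_operator {G : Type*} {H : Type*} [NormedAddCommGroup H]
    [InnerProductSpace ℂ H] [CompleteSpace H] {π : G → H →L[ℂ] H} {η : H}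
    (h : IsRieszSequence π η) :
    ∃ T : lp (fun _ : G => ℂ) 2 →L[ℂ] H,
      (∀ f, HasSum (fun g => f g • π g η) (T f)) ∧ (∀ f, T f = 0 → f = 0) ∧
      ∀ y, Summable fun g => ‖⟪y, π g η⟫_ℂ‖ ^ 2 := by
  classical
  obtain ⟨A, B, hA, hB, hAB⟩ := h.exists_bounds
  have hbessel := sum_norm_inner_sq_le_of_norm_sum_smul_sq_le hB fun s c => (hAB s c).2
  obtain ⟨Φ, hΦ⟩ := exists_analysis_operator hbessel
  have hsingle : ∀ g (a : ℂ), Φ.adjoint (lp.single 2 g a) = a • π g η := fun g a => by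
    refine ext_inner_right ℂ fun y => ?_
    rw [ContinuousLinearMap.adjoint_inner_left, lp.inner_single_left, hΦ, inner_smul_left]
    simp [mul_comm]
  have hT : ∀ f, HasSum (fun g => f g • π g η) (Φ.adjoint f) := fun f => by
    simpa only [Function.comp_def, hsingle] using
      (lp.hasSum_single ENNReal.ofNat_ne_top f).map Φ.adjoint Φ.adjoint.continuous
  refine ⟨Φ.adjoint, hT, fun f hf => ?_, fun y => ?_⟩
  · have hle : A * ‖f‖ ^ 2 ≤ ‖Φ.adjoint f‖ ^ 2 := by
      rw [lp_two_norm_sq_eq_tsum]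
      refine le_of_tendsto_of_tendsto'
        ((memℓp_two_iff_summable_sq.1 (lp.memℓp f)).hasSum.const_mul A) ((hT f).norm.pow 2)
        fun s => (hAB s f).1
    rw [hf, norm_zero] at hle
    have : ‖f‖ ^ 2 ≤ 0 := by nlinarith
    exact norm_eq_zero.1 (pow_eq_zero_iff two_ne_zero |>.1 (this.antisymm (sq_nonneg _)))
  · simpa only [norm_inner_symm] using summable_of_sum_le (fun i => by positivity) (hbessel y)

/-- The unitary operator on `ℓ²(G)` composing with a permutation of `G` and multiplying by a
unimodular function. -/
theorem exists_weighted_composition {G : Type*} (σ : Equiv.Perm G) (c : G → ℂ)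
    (hc : ∀ g, ‖c g‖ = 1) :
    ∃ U : lp (fun _ : G => ℂ) 2 ≃ₗᵢ[ℂ] lp (fun _ : G => ℂ) 2,
      ∀ f g, U f g = c g * f (σ g) := by
  have hmem : ∀ (τ : Equiv.Perm G) (d : G → ℂ) (_ : ∀ g, ‖d g‖ = 1)
      (f : lp (fun _ : G => ℂ) 2), Memℓp (fun g => d g * f (τ g)) 2 := fun τ d hd f => by
    rw [memℓp_two_iff_summable_sq]
    simpa [hd, Function.comp_def] using
      τ.summable_iff.2 (memℓp_two_iff_summable_sq.1 (lp.memℓp f))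
  let L : lp (fun _ : G => ℂ) 2 →ₗᵢ[ℂ] lp (fun _ : G => ℂ) 2 :=
    { toFun := fun f => ⟨fun g => c g * f (σ g), hmem σ c hc f⟩
      map_add' := fun f f' => by ext g; exact mul_add _ _ _
      map_smul' := fun a f => by ext g; simp [mul_left_comm]
      norm_map' := fun f => by
        refine (sq_eq_sq₀ (norm_nonneg _) (norm_nonneg _)).1 ?_
        rw [lp_two_norm_sq_eq_tsum, lp_two_norm_sq_eq_tsum]
        simpa [hc] using σ.tsum_eq fun g => ‖f g‖ ^ 2 }
  refine ⟨LinearIsometryEquiv.ofSurjective L fun f => ?_, fun f g => rfl⟩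
  refine ⟨⟨fun g => (c (σ.symm g))⁻¹ * f (σ.symm g),
    hmem σ.symm (fun g => (c (σ.symm g))⁻¹) (by simp [hc]) f⟩, ?_⟩
  ext g
  have : c g ≠ 0 := norm_ne_zero_iff.1 (by simp [hc])
  simp [L, this]

/-- The range of the analysis operator `Θ_ξ`, as a subspace of `ℓ²(G)`. -/
def analysisRange {G : Type*} {H : Type*} [NormedAddCommGroup H] [InnerProductSpace ℂ H]
    (π : G → H →L[ℂ] H) (ξ : H) : Submodule ℂ (lp (fun _ : G => ℂ) 2) where
  carrier := {F | ∃ y : H, Summable (fun g : G => ‖⟪y, π g ξ⟫_ℂ‖ ^ 2) ∧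
    ∀ g : G, F g = ⟪y, π g ξ⟫_ℂ}
  zero_mem' := ⟨0, by simp⟩
  add_mem' := by
    rintro F F' ⟨y, -, hF⟩ ⟨y', -, hF'⟩
    have h : ∀ g, (F + F') g = ⟪y + y', π g ξ⟫_ℂ := fun g => by
      simp [hF, hF']
    exact ⟨y + y', by simpa only [h] using memℓp_two_iff_summable_sq.1 (lp.memℓp (F + F')), h⟩
  smul_mem' := by
    rintro a F ⟨y, -, hF⟩
    have h : ∀ g, (a • F) g = ⟪starRingEnd ℂ a • y, π g ξ⟫_ℂ := fun g => by
      simp [hF, mul_comm]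
    exact ⟨_, by simpa only [h] using memℓp_two_iff_summable_sq.1 (lp.memℓp (a • F)), h⟩

namespace IsProjUnitaryRep

variable {G : Type*} [Group G] {H : Type*} [NormedAddCommGroup H] [InnerProductSpace ℂ H]
  {mu : G → G → ℂ} {π : G → H →L[ℂ] H}

theorem inner_map_map (hπ : IsProjUnitaryRep mu π) (g : G) (x y : H) :
    ⟪π g x, π g y⟫_ℂ = ⟪x, y⟫_ℂ :=
  LinearIsometry.inner_map_map ⟨(π g).toLinearMap, (hπ.2.1 g).1⟩ x y

theorem apply_apply (hπ : IsProjUnitaryRep mu π) (g h : G) (x : H) :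
    π g (π h x) = mu g h • π (g * h) x :=
  DFunLike.congr_fun (hπ.2.2 g h) x

theorem mu_one_right [Nontrivial H] (hπ : IsProjUnitaryRep mu π) (g : G) :
    mu g 1 = mu 1 1 := by
  obtain ⟨x, hx⟩ := exists_ne (0 : H)
  have hone : ∀ z, π 1 z = mu 1 1 • z := fun z => by
    obtain ⟨w, rfl⟩ := (hπ.2.1 1).2 z
    simpa using hπ.apply_apply 1 1 w
  have hgx : π g x ≠ 0 := norm_ne_zero_iff.1 (by rwa [(hπ.2.1 g).1, norm_ne_zero_iff])
  have h := hπ.apply_apply g 1 x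
  rw [hone, map_smul, mul_one] at h
  exact (smul_left_injective ℂ hgx h).symm

/-- The left regular representation on `ℓ²(G)` twisted by the conjugate multiplier. -/
theorem exists_twisted_translation (hπ : IsProjUnitaryRep mu π) (k : G) :
    ∃ U : lp (fun _ : G => ℂ) 2 ≃ₗᵢ[ℂ] lp (fun _ : G => ℂ) 2,
      ∀ f g, U f (k * g) = starRingEnd ℂ (mu k g) * f g := by
  obtain ⟨U, hU⟩ := exists_weighted_composition (Equiv.mulLeft k⁻¹)
    (fun g => starRingEnd ℂ (mu k (k⁻¹ * g))) fun g => by simp [hπ.1]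
  exact ⟨U, fun f g => by simp [hU]⟩

theorem inner_map_apply_mul (hπ : IsProjUnitaryRep mu π) (k g : G) (x y : H) :
    ⟪π k y, π (k * g) x⟫_ℂ = starRingEnd ℂ (mu k g) * ⟪y, π g x⟫_ℂ := by
  have h : starRingEnd ℂ (mu k g) * mu k g = 1 := by
    rw [mul_comm, Complex.mul_conj', hπ.1]; simp
  rw [← hπ.inner_map_map k y, hπ.apply_apply, inner_smul_right, ← mul_assoc, h, one_mul]

theorem map_analysisRange (hπ : IsProjUnitaryRep mu π) (ξ : H) (k : G)
    (U : lp (fun _ : G => ℂ) 2 ≃ₗᵢ[ℂ] lp (fun _ : G => ℂ) 2)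
    (hU : ∀ f g, U f (k * g) = starRingEnd ℂ (mu k g) * f g) :
    (analysisRange π ξ).map (U.toLinearEquiv : _ →ₗ[ℂ] lp (fun _ : G => ℂ) 2) =
      analysisRange π ξ := by
  have key : ∀ F y, (∀ g, F g = ⟪y, π g ξ⟫_ℂ) ↔ ∀ g, U F g = ⟪π k y, π g ξ⟫_ℂ := fun F y => by
    rw [← (Equiv.mulLeft k).forall_congr_right (q := fun g => U F g = ⟪π k y, π g ξ⟫_ℂ)]
    refine forall_congr' fun g => ?_
    have : starRingEnd ℂ (mu k g) ≠ 0 := norm_ne_zero_iff.1 (by simp [hπ.1])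
    simp [hU, hπ.inner_map_apply_mul, this]
  have hmem : ∀ F, F ∈ analysisRange π ξ ↔ ∃ y, ∀ g, F g = ⟪y, π g ξ⟫_ℂ := fun F =>
    ⟨fun ⟨y, _, h⟩ => ⟨y, h⟩, fun ⟨y, h⟩ =>
      ⟨y, by simpa only [h] using memℓp_two_iff_summable_sq.1 (lp.memℓp F), h⟩⟩
  ext F
  rw [Submodule.mem_map]
  constructor
  · rintro ⟨F, hF, rfl⟩
    obtain ⟨y, hy⟩ := (hmem F).1 hF
    exact (hmem _).2 ⟨π k y, (key F y).1 hy⟩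
  · intro hF
    obtain ⟨z, hz⟩ := (hmem F).1 hF
    obtain ⟨y, rfl⟩ := (hπ.2.1 k).2 z
    exact ⟨U.symm F, (hmem _).2 ⟨y, (key _ y).2 (by simpa using hz)⟩, U.apply_symm_apply F⟩

end IsProjUnitaryRep

/-- If `π` is a projective unitary representation of a countable group `G` on a complex
separable Hilbert space with dense Bessel vectors admitting a Riesz sequence, and the
closure of the range of the analysis operator `Θ_ξ` is not all of `ℓ²(G)`, then there is a
nonzero `x ∈ H` whose analysis range is orthogonal to that of `ξ`. -/
theorem exists_orthogonal_of_range_ne_top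
    {G : Type*} [Group G] [Countable G]
    {H : Type*} [NormedAddCommGroup H] [InnerProductSpace ℂ H] [CompleteSpace H]
    [TopologicalSpace.SeparableSpace H]
    (mu : G → G → ℂ) (π : G → H →L[ℂ] H) (hπ : IsProjUnitaryRep mu π)
    (hdense : Dense {y : H | IsBesselVector π y})
    (hriesz : ∃ η : H, IsRieszSequence π η) (ξ : H)
    (hne : closure {F : lp (fun _ : G => ℂ) 2 |
        ∃ y : H, Summable (fun g : G => ‖⟪y, π g ξ⟫_ℂ‖ ^ 2) ∧ ∀ g : G, F g = ⟪y, π g ξ⟫_ℂ}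
      ≠ Set.univ) :
    ∃ x : H, x ≠ 0 ∧ PiOrthogonal π x ξ := by
  classical
  obtain ⟨η, hη⟩ := hriesz
  obtain ⟨T, hT, hTinj, hsum⟩ := hη.exists_synthesis_operator
  set M := (analysisRange π ξ)ᗮ with hM
  have hMbot : M ≠ ⊥ := fun h => hne <| by
    have := (Submodule.topologicalClosure_eq_top_iff (K := analysisRange π ξ)).2 h
    exact congrArg SetLike.coe this
  choose U hU using hπ.exists_twisted_translation
  have hUM : ∀ k, M.map ((U k).toLinearEquiv : _ →ₗ[ℂ] lp (fun _ : G => ℂ) 2) = M := fun k => by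
    rw [hM, Submodule.map_orthogonal_equiv, hπ.map_analysisRange ξ k (U k) (hU k)]
  have hUP : ∀ k f, U k (M.starProjection f) = M.starProjection (U k f) := fun k f => by
    have h := Submodule.starProjection_map_apply (U k) M (U k f)
    simp only [hUM, LinearIsometryEquiv.symm_apply_apply] at h
    exact h.symm
  set v := M.starProjection (lp.single 2 (1 : G) (1 : ℂ)) with hv
  have hUsingle : ∀ k, U k (lp.single 2 1 1) =
      starRingEnd ℂ (mu k 1) • lp.single 2 k (1 : ℂ) := fun k => by
    ext g
    obtain ⟨g, rfl⟩ := (Equiv.mulLeft k).surjective g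
    rw [Equiv.coe_mulLeft, hU]
    by_cases hg : g = 1 <;> simp [hg]
  have hUv : ∀ k, U k v =
      starRingEnd ℂ (mu k 1) • M.starProjection (lp.single 2 k (1 : ℂ)) := fun k => by
    rw [hv, hUP, hUsingle, map_smul]
  -- coefficients of the projection onto `M`, read off from `v`
  have hcoef : ∀ k F, ⟪U k v, F⟫_ℂ = mu k 1 * M.starProjection F k := fun k F => by
    rw [hUv, inner_smul_left, Submodule.inner_starProjection_left_eq_right,
      lp.inner_single_left]
    simp
  have hv0 : v ≠ 0 := fun h => hMbot <| (Submodule.eq_bot_iff _).2 fun F hF => by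
    ext k
    have hmu : mu k 1 ≠ 0 := norm_ne_zero_iff.1 (by simp [hπ.1])
    have := hcoef k F
    rw [h, map_zero, inner_zero_left, Submodule.starProjection_eq_self_iff.2 hF] at this
    simpa [hmu] using this.symm
  have hx0 : T (star v) ≠ 0 := fun h => hv0 (star_eq_zero.1 (hTinj _ h))
  have : Nontrivial H := ⟨_, _, hx0⟩
  let Θ : H → lp (fun _ : G => ℂ) 2 := fun y =>
    ⟨fun g => ⟪y, π g η⟫_ℂ, memℓp_two_iff_summable_sq.2 (hsum y)⟩
  have hanalysis : ∀ y k, ⟪y, π k (T (star v))⟫_ℂ = mu 1 1 * M.starProjection (Θ y) k := by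
    intro y k
    rw [← hπ.mu_one_right k, ← hcoef]
    have h₁ := ((hT (star v)).mapL ((innerSL ℂ y).comp (π k)))
    have h₂ := (Equiv.mulLeft k).hasSum_iff.2 (lp.hasSum_inner (𝕜 := ℂ) (U k v) (Θ y))
    refine h₁.unique ?_
    convert h₂ using 2 with g
    simp [hU, Θ, hπ.apply_apply]
    ring
  refine ⟨T (star v), hx0, fun a b _ hb => ?_⟩
  let F : lp (fun _ : G => ℂ) 2 :=
    ⟨fun g => ⟪b, π g ξ⟫_ℂ, memℓp_two_iff_summable_sq.2 hb⟩
  have hF : F ∈ analysisRange π ξ := ⟨b, hb, fun g => rfl⟩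
  have horth : ⟪mu 1 1 • M.starProjection (Θ a), F⟫_ℂ = 0 := by
    rw [inner_smul_left, Submodule.inner_left_of_mem_orthogonal hF
      (Submodule.starProjection_apply_mem _ _), mul_zero]
  rw [← horth, lp.inner_eq_tsum]
  refine tsum_congr fun g => ?_
  simp [hanalysis, F, mul_comm]
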